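/- For every M > 0, there exists a finite set I ⊆ ℝ² with |I| odd such that the yolk radius r of I is strictly positive and, for every yolk B(c,r) of I and every LP yolk B(c',r') of I, the distance between the centers satisfies ‖c − c'‖₂ ≥ M·r. -/

import Mathlib

open scoped RealInnerProductSpace
open Real

noncomputable section

/-- Points of Euclidean space `ℝ^k`. -/
abbrev Pt (k : ℕ) := EuclideanSpace ℝ (Fin k)

/-- `(a, b)` (with `‖a‖ = 1`) is a median hyperplane for the finite set of ideal points `I`:
at least `|I|/2` points are on each closed side. -/
def IsMedianHyperplane {k : ℕ} (I : Finset (Pt k)) (a : Pt k) (b : ℝ) : Prop :=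
  ‖a‖ = 1 ∧
    (I.card : ℝ) / 2 ≤ ((I.filter fun x => ⟪a, x⟫ ≤ b).card : ℝ) ∧
    (I.card : ℝ) / 2 ≤ ((I.filter fun x => b ≤ ⟪a, x⟫).card : ℝ)

/-- A limiting median hyperplane for `I ⊆ ℝ^k` is a median hyperplane containing at least
`k` points of `I`. -/
def IsLimitingMedianHyperplane {k : ℕ} (I : Finset (Pt k)) (a : Pt k) (b : ℝ) : Prop :=
  IsMedianHyperplane I a b ∧ k ≤ (I.filter fun x => ⟪a, x⟫ = b).card

/-- The yolk radius: infimum of `r ≥ 0` such that some closed ball `B(c,r)` intersects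
every median hyperplane of `I` (the ball `B(c,r)` meets `H(a,b)` iff `|⟪a,c⟫ - b| ≤ r`). -/
def yolkRadius {k : ℕ} (I : Finset (Pt k)) : ℝ :=
  sInf {r : ℝ | 0 ≤ r ∧ ∃ c : Pt k, ∀ a b, IsMedianHyperplane I a b → |⟪a, c⟫ - b| ≤ r}

/-- The LP yolk radius: infimum of `r ≥ 0` such that some closed ball `B(c,r)` intersects
every limiting median hyperplane of `I`. -/
def lpYolkRadius {k : ℕ} (I : Finset (Pt k)) : ℝ :=
  sInf {r : ℝ | 0 ≤ r ∧ ∃ c : Pt k, ∀ a b, IsLimitingMedianHyperplane I a b → |⟪a, c⟫ - b| ≤ r}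

/-- `B(c,r)` is a yolk of `I`: it intersects every median hyperplane, and every closed ball
intersecting every median hyperplane has radius at least `r`. -/
def IsYolk {k : ℕ} (I : Finset (Pt k)) (c : Pt k) (r : ℝ) : Prop :=
  (∀ a b, IsMedianHyperplane I a b → |⟪a, c⟫ - b| ≤ r) ∧
  ∀ (c' : Pt k) (r' : ℝ),
    (∀ a b, IsMedianHyperplane I a b → |⟪a, c'⟫ - b| ≤ r') → r ≤ r'

/-- `B(c,r)` is an LP yolk of `I`: it intersects every limiting median hyperplane, and every
closed ball intersecting every limiting median hyperplane has radius at least `r`. -/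
def IsLPYolk {k : ℕ} (I : Finset (Pt k)) (c : Pt k) (r : ℝ) : Prop :=
  (∀ a b, IsLimitingMedianHyperplane I a b → |⟪a, c⟫ - b| ≤ r) ∧
  ∀ (c' : Pt k) (r' : ℝ),
    (∀ a b, IsLimitingMedianHyperplane I a b → |⟪a, c'⟫ - b| ≤ r') → r ≤ r'

/-- A set of points possesses a yolk as soon as, for some radius, the centers of balls of that
radius meeting every median hyperplane form a nonempty bounded set. -/
lemma exists_isYolk_of_bounded {k : ℕ} (I : Finset (Pt k)) {r₀ R : ℝ}
    (hne : ∃ a b, IsMedianHyperplane I a b)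
    (c₀ : Pt k) (hc₀ : ∀ a b, IsMedianHyperplane I a b → |⟪a, c₀⟫ - b| ≤ r₀)
    (hR : ∀ c : Pt k, (∀ a b, IsMedianHyperplane I a b → |⟪a, c⟫ - b| ≤ r₀) → ‖c‖ ≤ R) :
    ∃ c r, IsYolk I c r := by
  obtain ⟨a₀, b₀, h₀⟩ := hne
  set K : Set (Pt k × ℝ) :=
    {z | (∀ a b, IsMedianHyperplane I a b → |⟪a, z.1⟫ - b| ≤ z.2) ∧ z.2 ≤ r₀} with hK
  have hclosed : IsClosed K := by
    simp only [hK, Set.ofPred_and, Set.ofPred_forall]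
    refine IsClosed.inter ?_ (isClosed_le (by fun_prop) (by fun_prop))
    exact isClosed_iInter fun a => isClosed_iInter fun b => isClosed_iInter fun _ =>
      isClosed_le (by fun_prop) (by fun_prop)
  have hcompact : IsCompact K := by
    refine ((isCompact_closedBall (0 : Pt k) R).prod (isCompact_Icc (a := 0) (b := r₀))).of_isClosed_subset
      hclosed ?_
    rintro ⟨c, r⟩ ⟨h, hr⟩
    refine ⟨?_, (abs_nonneg _).trans (h a₀ b₀ h₀), hr⟩
    rw [mem_closedBall_zero_iff]
    exact hR c fun a b hab => (h a b hab).trans hr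
  obtain ⟨⟨c, r⟩, ⟨h, hr⟩, hmin⟩ :=
    hcompact.exists_isMinOn ⟨(c₀, r₀), hc₀, le_rfl⟩ continuous_snd.continuousOn
  refine ⟨c, r, h, fun c' r' h' => ?_⟩
  by_cases hr' : r' ≤ r₀
  · exact hmin (show (c', r') ∈ K from ⟨h', hr'⟩)
  · exact hr.trans (not_le.mp hr').le

/-- Five points that flatten onto the horizontal axis as `ε` tends to `0`. -/
def flatPoint (ε : ℝ) : Fin 5 → Pt 2 :=
  ![!₂[0, 0], !₂[-1, 3 * ε], !₂[-1, -(3 * ε)], !₂[1, ε], !₂[1, -ε]]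

lemma flatPoint_injective {ε : ℝ} (hε : 0 < ε) : Function.Injective (flatPoint ε) := by
  intro i j hij
  have h0 := congrArg (fun x : Pt 2 => x 0) hij
  have h1 := congrArg (fun x : Pt 2 => x 1) hij
  fin_cases i <;> fin_cases j <;> simp [flatPoint] at h0 h1 ⊢ <;> linarith

open Classical in
/-- The set of the points `flatPoint ε i`. -/
def flatSet (ε : ℝ) : Finset (Pt 2) := Finset.univ.image (flatPoint ε)

lemma card_filter_flatSet {ε : ℝ} (hε : 0 < ε) (P : Pt 2 → Prop) [DecidablePred P] :
    ((flatSet ε).filter P).card = ∑ i, if P (flatPoint ε i) then 1 else 0 := by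
  classical
  rw [flatSet, Finset.filter_image, Finset.card_image_of_injective _ (flatPoint_injective hε),
    Finset.card_filter]

lemma card_flatSet {ε : ℝ} (hε : 0 < ε) : (flatSet ε).card = 5 := by
  classical
  rw [flatSet, Finset.card_image_of_injective _ (flatPoint_injective hε)]
  simp

lemma inner_pt_two (a x : Pt 2) : ⟪a, x⟫ = a 0 * x 0 + a 1 * x 1 := by
  simp [PiLp.inner_apply, Fin.sum_univ_two, mul_comm]

lemma norm_eq_one_iff_pt_two (a : Pt 2) : ‖a‖ = 1 ↔ a 0 ^ 2 + a 1 ^ 2 = 1 := by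
  simp [EuclideanSpace.norm_eq, Fin.sum_univ_two]

/-- The number of points of `flatSet ε` whose inner product with `a` satisfies `P`. -/
lemma card_filter_inner_flatSet {ε : ℝ} (hε : 0 < ε) (a : Pt 2) (P : ℝ → Prop) [DecidablePred P] :
    ((flatSet ε).filter fun x => P ⟪a, x⟫).card =
      (if P 0 then 1 else 0) + (if P (-a 0 + 3 * ε * a 1) then 1 else 0) +
      (if P (-a 0 - 3 * ε * a 1) then 1 else 0) + (if P (a 0 + ε * a 1) then 1 else 0) +
      (if P (a 0 - ε * a 1) then 1 else 0) := by
  rw [card_filter_flatSet hε, Fin.sum_univ_five]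
  simp only [inner_pt_two]
  have e0 : a 0 * flatPoint ε 0 0 + a 1 * flatPoint ε 0 1 = 0 := by simp [flatPoint]
  have e1 : a 0 * flatPoint ε 1 0 + a 1 * flatPoint ε 1 1 = -a 0 + 3 * ε * a 1 := by
    simp [flatPoint]; ring
  have e2 : a 0 * flatPoint ε 2 0 + a 1 * flatPoint ε 2 1 = -a 0 - 3 * ε * a 1 := by
    simp [flatPoint]; ring
  have e3 : a 0 * flatPoint ε 3 0 + a 1 * flatPoint ε 3 1 = a 0 + ε * a 1 := by
    simp [flatPoint]; ring
  have e4 : a 0 * flatPoint ε 4 0 + a 1 * flatPoint ε 4 1 = a 0 - ε * a 1 := by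
    simp [flatPoint]; ring
  rw [e0, e1, e2, e3, e4]

lemma isMedianHyperplane_flatSet_iff {ε : ℝ} (hε : 0 < ε) (a : Pt 2) (b : ℝ) :
    IsMedianHyperplane (flatSet ε) a b ↔ ‖a‖ = 1 ∧
      3 ≤ ((flatSet ε).filter fun x => ⟪a, x⟫ ≤ b).card ∧
      3 ≤ ((flatSet ε).filter fun x => b ≤ ⟪a, x⟫).card := by
  have key (n : ℕ) : ((5 : ℕ) : ℝ) / 2 ≤ n ↔ 3 ≤ n := by
    rw [div_le_iff₀ two_pos]
    norm_cast
    lia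
  rw [IsMedianHyperplane, card_flatSet hε, key, key]

lemma abs_le_of_isMedianHyperplane_flatSet {ε : ℝ} (hε : 0 < ε) {a : Pt 2} {b : ℝ}
    (h : IsMedianHyperplane (flatSet ε) a b) : |b| ≤ ε := by
  rw [isMedianHyperplane_flatSet_iff hε, card_filter_inner_flatSet hε a (fun t => t ≤ b),
    card_filter_inner_flatSet hε a (fun t => b ≤ t), norm_eq_one_iff_pt_two] at h
  obtain ⟨ha, hle, hge⟩ := h
  have hq : |a 1| ≤ 1 := by
    rw [← sq_le_one_iff_abs_le_one]
    linarith [sq_nonneg (a 0)]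
  obtain ⟨hq1, hq2⟩ := abs_le.mp hq
  have h1 : ε * a 1 ≤ ε := mul_le_of_le_one_right hε.le hq2
  have h2 : -ε ≤ ε * a 1 := by nlinarith
  rw [abs_le]
  constructor
  · by_contra! hb
    split_ifs at hle <;> first | lia | linarith
  · by_contra! hb
    split_ifs at hge <;> first | lia | linarith

lemma isMedianHyperplane_flatSet_vertical {ε : ℝ} (hε : 0 < ε) :
    IsMedianHyperplane (flatSet ε) !₂[1, 0] 0 := by
  rw [isMedianHyperplane_flatSet_iff hε, card_filter_inner_flatSet hε _ (fun t => t ≤ 0),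
    card_filter_inner_flatSet hε _ (fun t => 0 ≤ t), norm_eq_one_iff_pt_two]
  norm_num

lemma isLimitingMedianHyperplane_flatSet {ε s : ℝ} (hε : 0 < ε) (hs : 0 < s)
    (h : s ^ 2 * (1 + 4 * ε ^ 2) = 1) {σ : ℝ} (hσ : σ = 1 ∨ σ = -1) :
    IsLimitingMedianHyperplane (flatSet ε) !₂[2 * ε * s, σ * s] (ε * s) := by
  have hes : 0 < ε * s := mul_pos hε hs
  rw [IsLimitingMedianHyperplane, isMedianHyperplane_flatSet_iff hε,
    card_filter_inner_flatSet hε _ (fun t => t ≤ ε * s),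
    card_filter_inner_flatSet hε _ (fun t => ε * s ≤ t),
    card_filter_inner_flatSet hε _ (fun t => t = ε * s), norm_eq_one_iff_pt_two]
  have n1 : (2 * ε * s) ^ 2 + (σ * s) ^ 2 = 1 := by
    rcases hσ with rfl | rfl <;> linarith
  refine ⟨⟨by simpa using n1, ?_, ?_⟩, ?_⟩ <;>
    simp only [Matrix.cons_val_zero, Matrix.cons_val_one] <;>
    rcases hσ with rfl | rfl
  all_goals
    ring_nf at hes ⊢
    split_ifs <;> first | lia | linarith

set_option maxHeartbeats 400000 in
lemma abs_sub_le_of_isLimitingMedianHyperplane_flatSet {ε : ℝ} (hε : 0 < ε) (hε' : ε ≤ 1 / 4)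
    {a : Pt 2} {b : ℝ} (h : IsLimitingMedianHyperplane (flatSet ε) a b) :
    |⟪a, !₂[1 / 5, 0]⟫ - b| ≤ 3 * ε / 5 := by
  obtain ⟨hmed, hcard⟩ := h
  have hb := abs_le.mp (abs_le_of_isMedianHyperplane_flatSet hε hmed)
  have ha := (norm_eq_one_iff_pt_two a).mp hmed.1
  rw [card_filter_inner_flatSet hε a (fun t => t = b)] at hcard
  have hq : |a 1| ≤ 1 := by
    rw [← sq_le_one_iff_abs_le_one]
    linarith [sq_nonneg (a 0)]
  obtain ⟨hq1, hq2⟩ := abs_le.mp hq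
  have h1 : ε * a 1 ≤ ε := mul_le_of_le_one_right hε.le hq2
  have h2 : -ε ≤ ε * a 1 := by nlinarith
  have hpq : ε < |a 0| ∨ ε < 2 * |ε * a 1| := by
    by_contra! hcon
    obtain ⟨hp, hq⟩ := hcon
    rw [abs_mul, abs_of_pos hε] at hq
    have hq' : |a 1| ≤ 1 / 2 := by nlinarith
    have := sq_le_sq' (by linarith [abs_nonneg (a 0)]) hp
    have := sq_le_sq' (by linarith [abs_nonneg (a 1)]) hq'
    rw [sq_abs] at *
    nlinarith
  rw [inner_pt_two]
  simp only [Matrix.cons_val_zero, Matrix.cons_val_one]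
  rw [lt_abs, ← abs_two, ← abs_mul, lt_abs] at hpq
  rw [abs_le]
  clear hmed ha hq hq1 hq2
  generalize a 0 = p at *
  simp only [mul_assoc] at *
  generalize ε * a 1 = e at *
  split_ifs at hcard <;>
    first
      | (exfalso; clear * - hcard; lia)
      | (clear hcard; rcases hpq with (hpq | hpq) | (hpq | hpq) <;> constructor <;> linarith)

lemma exists_isYolk_flatSet {ε : ℝ} (hε : 0 < ε) {s : ℝ} (hs : 0 < s)
    (h : s ^ 2 * (1 + 4 * ε ^ 2) = 1) : ∃ c r, IsYolk (flatSet ε) c r := by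
  refine exists_isYolk_of_bounded (flatSet ε) (r₀ := ε) (R := ε + ε / s)
    ⟨_, _, isMedianHyperplane_flatSet_vertical hε⟩ 0 ?_ ?_
  · intro a b hab
    simpa using abs_le_of_isMedianHyperplane_flatSet hε hab
  · intro c hc
    have h0 := hc _ _ (isMedianHyperplane_flatSet_vertical hε)
    have h1 := hc _ _ (isLimitingMedianHyperplane_flatSet hε hs h (Or.inl rfl)).1
    have h2 := hc _ _ (isLimitingMedianHyperplane_flatSet hε hs h (Or.inr rfl)).1
    simp only [inner_pt_two, Matrix.cons_val_zero, Matrix.cons_val_one,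
      abs_le] at h0 h1 h2
    have hx : |c 0| ≤ ε := abs_le.mpr ⟨by linarith, by linarith⟩
    have hy : |c 1| ≤ ε / s := by
      rw [abs_le, ← neg_div, div_le_iff₀ hs, le_div_iff₀ hs]
      constructor <;> linarith
    rw [EuclideanSpace.norm_eq, Fin.sum_univ_two]
    refine Real.sqrt_le_iff.mpr ⟨by positivity, ?_⟩
    have hes : 0 < ε / s := by positivity
    simp only [Real.norm_eq_abs]
    nlinarith [abs_nonneg (c 0), abs_nonneg (c 1)]

lemma abs_apply_zero_le_of_isYolk_flatSet {ε : ℝ} (hε : 0 < ε) {c : Pt 2} {r : ℝ}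
    (hc : IsYolk (flatSet ε) c r) : |c 0| ≤ r := by
  simpa [inner_pt_two] using hc.1 _ _ (isMedianHyperplane_flatSet_vertical hε)

lemma pos_of_isYolk_flatSet {ε s : ℝ} (hε : 0 < ε) (hs : 0 < s)
    (h : s ^ 2 * (1 + 4 * ε ^ 2) = 1) {c : Pt 2} {r : ℝ} (hc : IsYolk (flatSet ε) c r) :
    0 < r := by
  by_contra! hr
  have hx : c 0 = 0 :=
    abs_nonpos_iff.mp ((abs_apply_zero_le_of_isYolk_flatSet hε hc).trans hr)
  have h1 := hc.1 _ _ (isLimitingMedianHyperplane_flatSet hε hs h (Or.inl rfl)).1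
  have h2 := hc.1 _ _ (isLimitingMedianHyperplane_flatSet hε hs h (Or.inr rfl)).1
  simp only [inner_pt_two, Matrix.cons_val_zero, Matrix.cons_val_one,
    abs_le, hx] at h1 h2
  linarith [mul_pos hε hs]

/-- For every `M > 0` there is a finite `I ⊆ ℝ²` with `|I|` odd, possessing a
yolk of strictly positive radius, such that every yolk center is at distance at least
`M` times the yolk radius from every LP yolk center. -/
theorem lp_yolk_center_arbitrarily_far (M : ℝ) (hM : 0 < M) :
    ∃ I : Finset (Pt 2), Odd I.card ∧
      (∃ (c : Pt 2) (r : ℝ), IsYolk I c r ∧ 0 < r) ∧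
      ∀ (c : Pt 2) (r : ℝ) (c' : Pt 2) (r' : ℝ),
        IsYolk I c r → IsLPYolk I c' r' → M * r ≤ ‖c - c'‖ := by
  set ε : ℝ := 3 / (20 * (M + 1)) with hεdef
  have hε : 0 < ε := by positivity
  have hMε : (M + 1) * ε = 3 / 20 := by
    rw [hεdef]
    field_simp
  have hε' : ε ≤ 1 / 4 := by nlinarith
  obtain ⟨s, hs, hsε⟩ : ∃ s : ℝ, 0 < s ∧ s ^ 2 * (1 + 4 * ε ^ 2) = 1 := by
    refine ⟨(√(1 + 4 * ε ^ 2))⁻¹, by positivity, ?_⟩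
    rw [inv_pow, Real.sq_sqrt (by positivity)]
    exact inv_mul_cancel₀ (by positivity)
  refine ⟨flatSet ε, by rw [card_flatSet hε]; decide, ?_, ?_⟩
  · obtain ⟨c, r, hc⟩ := exists_isYolk_flatSet hε hs hsε
    exact ⟨c, r, hc, pos_of_isYolk_flatSet hε hs hsε hc⟩
  · intro c r c' r' hc hc'
    have hr : r ≤ ε := hc.2 0 ε fun a b hab => by
      simpa using abs_le_of_isMedianHyperplane_flatSet hε hab
    have hr' : r' ≤ 3 * ε / 5 :=
      hc'.2 _ _ fun a b hab => abs_sub_le_of_isLimitingMedianHyperplane_flatSet hε hε' hab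
    have hx : |c 0| ≤ r := abs_apply_zero_le_of_isYolk_flatSet hε hc
    have hx' : 3 / 20 ≤ c' 0 := by
      have h1 := hc'.1 _ _ (isLimitingMedianHyperplane_flatSet hε hs hsε (Or.inl rfl))
      have h2 := hc'.1 _ _ (isLimitingMedianHyperplane_flatSet hε hs hsε (Or.inr rfl))
      simp only [inner_pt_two, Matrix.cons_val_zero, Matrix.cons_val_one,
        abs_le] at h1 h2
      have hs' : 6 / 7 ≤ s := by
        by_contra! hcon
        have hε2 : ε ^ 2 ≤ 1 / 16 := by nlinarith
        nlinarith
      have h3 : -(3 / 5) ≤ s * (2 * c' 0 - 1) := by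
        refine le_of_mul_le_mul_left ?_ hε
        linarith
      by_contra! hcon
      nlinarith
    calc M * r ≤ M * ε := by gcongr
      _ ≤ c' 0 - c 0 := by linarith [le_abs_self (c 0)]
      _ ≤ |(c - c') 0| := by
        rw [PiLp.sub_apply, abs_sub_comm]
        exact le_abs_self _
      _ ≤ ‖c - c'‖ := PiLp.norm_apply_le (c - c') 0
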